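/- Let Σ = (A,B) and Σ' = (A',B') be two reachable systems of size (n,m) over a commutative von Neumann regular ring R. Then Σ and Σ' are feedback equivalent if and only if for every k = 1,…,n the matrices [B|AB|…|A^{k−1}B] and [B'|A'B'|…|A'^{k−1}B'] are equivalent over R (i.e., they have the same invariant factors). -/

import Mathlib

open Matrix

/-- Feedback equivalence of linear systems `(A, B)` and `(A', B')`:
`A' = P(A + BK)P⁻¹` and `B' = PBQ` for some invertible `P`, `Q` and some `K`. -/
def FeedbackEquiv {n m : Type*} [Fintype n] [DecidableEq n] [Fintype m] [DecidableEq m]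
    (R : Type*) [CommRing R]
    (A : Matrix n n R) (B : Matrix n m R)
    (A' : Matrix n n R) (B' : Matrix n m R) : Prop :=
  ∃ (P : GL n R) (Q : GL m R) (K : Matrix m n R),
    A' = (P : Matrix n n R) * (A + B * K) * ((P⁻¹ : GL n R) : Matrix n n R) ∧
    B' = (P : Matrix n n R) * B * (Q : Matrix m m R)

/-- Two rectangular matrices are equivalent over `R` if `B' = P * B * Q`
for some invertible `P`, `Q`. -/
def MatrixEquivRel {n m : Type*} [Fintype n] [DecidableEq n] [Fintype m] [DecidableEq m]
    (R : Type*) [CommRing R] (B B' : Matrix n m R) : Prop :=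
  ∃ (P : GL n R) (Q : GL m R), B' = (P : Matrix n n R) * B * (Q : Matrix m m R)

/-- The partial reachability matrix `[B | AB | ... | A^(k-1)B]`, with its
columns indexed by `Fin k × Fin m`. -/
def reachMatrix {n m : ℕ} (R : Type*) [CommRing R]
    (A : Matrix (Fin n) (Fin n) R) (B : Matrix (Fin n) (Fin m) R) (k : ℕ) :
    Matrix (Fin n) (Fin k × Fin m) R :=
  Matrix.of fun i p => (A ^ (p.1 : ℕ) * B) i p.2

/-- The module of states reachable in at most `k` steps. -/
def Nmod {n m : Type*} [Fintype n] [DecidableEq n] [Fintype m]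
    (R : Type*) [CommRing R]
    (A : Matrix n n R) (B : Matrix n m R) (k : ℕ) : Submodule R (n → R) :=
  Submodule.span R { x : n → R | ∃ i < k, ∃ j : m, x = fun p => (A ^ i * B) p j }

/-- A system `(A, B)` is reachable if the columns of `[B | AB | ... | A^(n-1)B]`
generate all of `R^n`. -/
def SysReachable {n m : Type*} [Fintype n] [DecidableEq n] [Fintype m]
    (R : Type*) [CommRing R]
    (A : Matrix n n R) (B : Matrix n m R) : Prop :=
  Nmod R A B (Fintype.card n) = ⊤

section LocalGlobal

variable {R : Type*} [CommRing R]

theorem exists_notMem_forall_mul_eq_zero (hreg : ∀ a : R, ∃ x : R, a ^ 2 * x = a)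
    (p : Ideal R) [p.IsPrime] {ι : Type*} [Fintype ι] (v : ι → R) (hv : ∀ i, v i ∈ p) :
    ∃ e ∉ p, ∀ i, e * v i = 0 := by
  have single : ∀ i, ∃ e ∈ p.primeCompl, e * v i = 0 := fun i => by
    obtain ⟨x, hx⟩ := hreg (v i)
    refine ⟨1 - v i * x, fun h => ?_, by linear_combination -hx⟩
    refine Ideal.IsPrime.one_notMem ‹_› ?_
    simpa using p.add_mem h (p.mul_mem_right x (hv i))
  choose e hep he using single
  refine ⟨∏ i, e i, prod_mem fun i _ => hep i, fun i => ?_⟩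
  exact zero_dvd_iff.mp (he i ▸ mul_dvd_mul_right (Finset.dvd_prod_of_mem e (Finset.mem_univ i)) _)

/-- Over a von Neumann regular ring, a solution of `F x = 0` exists as soon as one exists
locally at every maximal ideal, provided that `F` is compatible with idempotents. -/
theorem exists_eq_zero_of_forall_isMaximal (hreg : ∀ a : R, ∃ x : R, a ^ 2 * x = a)
    {T M : Type*} [AddCommGroup T] [Module R T] [AddCommGroup M] [Module R M] (F : T → M)
    (hF : ∀ e : R, e * e = e → ∀ x y, e • x = e • y → e • F x = e • F y)
    (hloc : ∀ p : Ideal R, p.IsMaximal → ∃ x, ∃ e ∉ p, e • F x = 0) :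
    ∃ x, F x = 0 := by
  let I : Ideal R :=
    { carrier := {e | ∃ x, e • F x = 0}
      zero_mem' := ⟨0, zero_smul _ _⟩
      smul_mem' := by
        rintro c e ⟨x, hx⟩
        exact ⟨x, by rw [smul_eq_mul, mul_smul, hx, smul_zero]⟩
      add_mem' := by
        rintro a b ⟨x, hx⟩ ⟨y, hy⟩
        obtain ⟨c, hc⟩ := hreg a
        have hee : a * c * (a * c) = a * c := by linear_combination c * hc
        have hff : (1 - a * c) * (1 - a * c) = 1 - a * c := by linear_combination hee
        have hfe : (1 - a * c) * (a * c) = 0 := by linear_combination -hee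
        set z := (a * c) • x + (1 - a * c) • y
        have h1 : (a * c) • F z = 0 := by
          rw [hF _ hee z x, mul_comm, mul_smul, hx, smul_zero]
          simp only [z, smul_add, smul_smul, hee, mul_comm (a * c) (1 - a * c), hfe, zero_smul,
            add_zero]
        have h2 : (1 - a * c) • F z = (1 - a * c) • F y := by
          refine hF _ hff z y ?_
          simp only [z, smul_add, smul_smul, hff, hfe, zero_smul, zero_add]
        have ha : a • F z = 0 := by
          rw [← hc, show a ^ 2 * c = a * (a * c) by ring, mul_smul, h1, smul_zero]
        have hb : b • F z = 0 := by
          rw [show b = b * (a * c) + (1 - a * c) * b by ring, add_smul, mul_smul, h1, mul_comm,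
            mul_smul, h2, smul_comm, hy]
          simp
        exact ⟨z, by rw [add_smul, ha, hb, add_zero]⟩ }
  by_cases hI : I = ⊤
  · obtain ⟨x, hx⟩ : (1 : R) ∈ I := hI ▸ Submodule.mem_top
    exact ⟨x, by simpa using hx⟩
  · obtain ⟨p, hp, hIp⟩ := Ideal.exists_le_maximal I hI
    obtain ⟨x, e, hep, hx⟩ := hloc p hp
    exact absurd (hIp ⟨x, hx⟩) hep

end LocalGlobal

section Field

variable {F : Type*} [Field F] {V V' W : Type*} [AddCommGroup V] [Module F V]
  [AddCommGroup V'] [Module F V'] [AddCommGroup W] [Module F W]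
  [FiniteDimensional F V] [FiniteDimensional F V']

theorem exists_linearEquiv_comp_eq_of_range_eq (f : V →ₗ[F] W) (g : V' →ₗ[F] W)
    (hfg : LinearMap.range f = LinearMap.range g)
    (hV : Module.finrank F V = Module.finrank F V') :
    ∃ P : V ≃ₗ[F] V', ∀ x, g (P x) = f x := by
  obtain ⟨C, hC⟩ := Submodule.exists_isCompl (LinearMap.ker f)
  obtain ⟨D, hD⟩ := Submodule.exists_isCompl (LinearMap.ker g)
  have hf := f.finrank_range_add_finrank_ker
  have hg := g.finrank_range_add_finrank_ker
  rw [hfg] at hf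
  let k : LinearMap.ker f ≃ₗ[F] LinearMap.ker g := LinearEquiv.ofFinrankEq _ _ (by omega)
  let r : C ≃ₗ[F] D :=
    (Submodule.quotientEquivOfIsCompl _ C hC).symm ≪≫ₗ f.quotKerEquivRange ≪≫ₗ
      LinearEquiv.ofEq _ _ hfg ≪≫ₗ g.quotKerEquivRange.symm ≪≫ₗ
      Submodule.quotientEquivOfIsCompl _ D hD
  have hr : ∀ c : C, g (r c) = f c := fun c => by
    have h : g.quotKerEquivRange ((Submodule.quotientEquivOfIsCompl _ D hD).symm (r c)) =
        LinearEquiv.ofEq _ _ hfg (f.quotKerEquivRange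
          ((Submodule.quotientEquivOfIsCompl _ C hC).symm c)) := by
      simp [r]
    simpa using congrArg Subtype.val h
  refine ⟨(Submodule.prodEquivOfIsCompl _ C hC).symm ≪≫ₗ k.prodCongr r ≪≫ₗ
    Submodule.prodEquivOfIsCompl _ D hD, fun x => ?_⟩
  obtain ⟨⟨a, c⟩, rfl⟩ := (Submodule.prodEquivOfIsCompl _ C hC).surjective x
  simp [hr]

theorem exists_linearEquiv_comp_eq_and_mem_iff (f : V →ₗ[F] W) (g : V' →ₗ[F] W)
    (hfg : LinearMap.range f = LinearMap.range g)
    (hV : Module.finrank F V = Module.finrank F V') (N : Submodule F V) (N' : Submodule F V')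
    (hN : N ≤ LinearMap.ker f) (hN' : N' ≤ LinearMap.ker g)
    (hNN : Module.finrank F N = Module.finrank F N') :
    ∃ P : V ≃ₗ[F] V', (∀ x, g (P x) = f x) ∧ ∀ x, P x ∈ N' ↔ x ∈ N := by
  have h1 := N.finrank_quotient_add_finrank
  have h2 := N'.finrank_quotient_add_finrank
  obtain ⟨Q, hQ⟩ := exists_linearEquiv_comp_eq_of_range_eq (N.liftQ f hN) (N'.liftQ g hN')
    (by rw [Submodule.range_liftQ, Submodule.range_liftQ, hfg]) (by omega)
  obtain ⟨P, hP⟩ := exists_linearEquiv_comp_eq_of_range_eq (Q.toLinearMap ∘ₗ N.mkQ) N'.mkQ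
    (by simp [LinearMap.range_comp]) hV
  refine ⟨P, fun x => ?_, fun x => ?_⟩
  · have := hQ (N.mkQ x)
    have h := hP x
    simp only [LinearMap.comp_apply, LinearEquiv.coe_coe] at h
    rw [← h] at this
    simpa using this
  · rw [← Submodule.Quotient.mk_eq_zero N', ← Submodule.mkQ_apply, hP]
    simp

/-- One descending step in the construction of a state isomorphism between two filtered systems:
compatibility modulo the filtration can be improved by one level. -/
theorem exists_linearEquiv_intertwining_step (a : V →ₗ[F] V) (a' : V' →ₗ[F] V')
    (hV : Module.finrank F V = Module.finrank F V')
    {L N S : Submodule F V} {L' N' S' : Submodule F V'}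
    (hLN : L ≤ N) (hL : ∀ x ∈ L, a x ∈ N) (hS : S ≤ N ⊔ N.map a)
    (hLN' : L' ≤ N') (hL' : ∀ x ∈ L', a' x ∈ N') (hS' : S' ≤ N' ⊔ N'.map a')
    (hLL : Module.finrank F L = Module.finrank F L')
    (P : V ≃ₗ[F] V') (hPN : ∀ x, P x ∈ N' ↔ x ∈ N) (hPS : ∀ x, P x ∈ S' ↔ x ∈ S)
    (hP : ∀ x, a' (P x) - P (a x) ∈ S') :
    ∃ Q : V ≃ₗ[F] V', (∀ x, Q x ∈ L' ↔ x ∈ L) ∧ (∀ x, Q x ∈ N' ↔ x ∈ N) ∧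
      ∀ x, a' (Q x) - Q (a x) ∈ N' := by
  let f : V →ₗ[F] (V' ⧸ N') × (V' ⧸ N') :=
    (N'.mkQ ∘ₗ P.toLinearMap).prod (N'.mkQ ∘ₗ P.toLinearMap ∘ₗ a)
  let g : V' →ₗ[F] (V' ⧸ N') × (V' ⧸ N') := N'.mkQ.prod (N'.mkQ ∘ₗ a')
  have hgf : ∀ x y, g y = f x ↔ y - P x ∈ N' ∧ a' y - P (a x) ∈ N' := fun x y => by
    simp [f, g, Prod.ext_iff, Submodule.Quotient.eq]
  have hfg : LinearMap.range f = LinearMap.range g := by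
    apply le_antisymm
    · rintro _ ⟨x, rfl⟩
      obtain ⟨w, hw, _, ⟨z, hz, rfl⟩, h⟩ := Submodule.mem_sup.mp (hS' (hP x))
      refine ⟨P x - z, (hgf _ _).mpr ⟨by simpa using hz, ?_⟩⟩
      rwa [map_sub, sub_right_comm, ← h, add_sub_cancel_right]
    · rintro _ ⟨y, rfl⟩
      obtain ⟨x, rfl⟩ := P.surjective y
      have hs : P.symm (a' (P x) - P (a x)) ∈ S := by
        rw [← hPS, P.apply_symm_apply]; exact hP x
      obtain ⟨w, hw, _, ⟨z, hz, rfl⟩, h⟩ := Submodule.mem_sup.mp (hS hs)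
      rw [LinearEquiv.eq_symm_apply, map_add] at h
      refine ⟨x + z, ((hgf _ _).mpr ⟨?_, ?_⟩).symm⟩
      · rw [← map_sub, hPN]; simpa using hz
      · rw [map_add, map_add, ← sub_sub, ← h, add_sub_cancel_right, hPN]
        exact hw
  obtain ⟨Q, hQ, hQL⟩ := exists_linearEquiv_comp_eq_and_mem_iff f g hfg hV L L'
    (fun x hx => by simpa [f, hPN] using ⟨hLN hx, hL x hx⟩)
    (fun x hx => by simpa [g] using ⟨hLN' hx, hL' x hx⟩) hLL
  have hQP : ∀ x, Q x - P x ∈ N' := fun x => ((hgf _ _).mp (hQ x)).1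
  refine ⟨Q, hQL, fun x => ?_, fun x => ?_⟩
  · rw [← hPN, ← N'.sub_mem_iff_left (hQP x)]
    simp
  · have := N'.sub_mem ((hgf _ _).mp (hQ x)).2 (hQP (a x))
    simpa using this

theorem exists_linearEquiv_intertwining (a : V →ₗ[F] V) (a' : V' →ₗ[F] V')
    (N : ℕ → Submodule F V) (N' : ℕ → Submodule F V')
    (hV : Module.finrank F V = Module.finrank F V')
    (hmono : ∀ k, N k ≤ N (k + 1)) (ha : ∀ k, ∀ x ∈ N k, a x ∈ N (k + 1))
    (hgen : ∀ k, N (k + 2) ≤ N (k + 1) ⊔ (N (k + 1)).map a)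
    (hmono' : ∀ k, N' k ≤ N' (k + 1)) (ha' : ∀ k, ∀ x ∈ N' k, a' x ∈ N' (k + 1))
    (hgen' : ∀ k, N' (k + 2) ≤ N' (k + 1) ⊔ (N' (k + 1)).map a')
    {n : ℕ} (hn : N n = ⊤) (hn' : N' n = ⊤)
    (hrank : ∀ k < n, Module.finrank F (N k) = Module.finrank F (N' k)) :
    ∃ P : V ≃ₗ[F] V', (∀ x, P x ∈ N' 1 ↔ x ∈ N 1) ∧ ∀ x, a' (P x) - P (a x) ∈ N' 1 := by
  suffices h : ∀ k ≤ n, ∃ P : V ≃ₗ[F] V', (∀ x, P x ∈ N' k ↔ x ∈ N k) ∧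
      (∀ x, P x ∈ N' (k + 1) ↔ x ∈ N (k + 1)) ∧ ∀ x, a' (P x) - P (a x) ∈ N' (k + 1) by
    obtain ⟨P, -, h⟩ := h 0 n.zero_le
    exact ⟨P, h⟩
  intro k hk
  induction hk using Nat.decreasingInduction with
  | self =>
    have h : N (n + 1) = ⊤ := top_le_iff.mp (hn ▸ hmono n)
    have h' : N' (n + 1) = ⊤ := top_le_iff.mp (hn' ▸ hmono' n)
    exact ⟨LinearEquiv.ofFinrankEq _ _ hV, by simp [hn, hn', h, h']⟩
  | of_succ k hk ih =>
    obtain ⟨P, h1, h2, h3⟩ := ih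
    exact exists_linearEquiv_intertwining_step a a' hV (hmono k) (ha k) (hgen k) (hmono' k)
      (ha' k) (hgen' k) (hrank k hk) P h1 h2 h3

end Field

section Reach

variable {R : Type*} [CommRing R] {n m : ℕ}

theorem range_reachMatrix_mulVecLin (A : Matrix (Fin n) (Fin n) R) (B : Matrix (Fin n) (Fin m) R)
    (k : ℕ) : LinearMap.range (reachMatrix R A B k).mulVecLin = Nmod R A B k := by
  rw [Matrix.range_mulVecLin, Nmod]
  congr 1
  ext x
  constructor
  · rintro ⟨⟨i, j⟩, rfl⟩
    exact ⟨i, i.2, j, rfl⟩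
  · rintro ⟨i, hi, j, rfl⟩
    exact ⟨(⟨i, hi⟩, j), rfl⟩

theorem col_mem_Nmod (A : Matrix (Fin n) (Fin n) R) (B : Matrix (Fin n) (Fin m) R) {i k : ℕ}
    (h : i < k) (j : Fin m) : (fun p => (A ^ i * B) p j) ∈ Nmod R A B k :=
  Submodule.subset_span ⟨i, h, j, rfl⟩

theorem Nmod_zero (A : Matrix (Fin n) (Fin n) R) (B : Matrix (Fin n) (Fin m) R) :
    Nmod R A B 0 = ⊥ := by
  simp [Nmod]

theorem Nmod_le_succ (A : Matrix (Fin n) (Fin n) R) (B : Matrix (Fin n) (Fin m) R) (k : ℕ) :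
    Nmod R A B k ≤ Nmod R A B (k + 1) :=
  Submodule.span_mono fun _ ⟨i, hi, h⟩ => ⟨i, hi.trans k.lt_succ_self, h⟩

theorem mulVec_pow_mul_col (A : Matrix (Fin n) (Fin n) R) (B : Matrix (Fin n) (Fin m) R)
    (i : ℕ) (j : Fin m) :
    A *ᵥ (fun p => (A ^ i * B) p j) = fun p => (A ^ (i + 1) * B) p j := by
  rw [pow_succ', Matrix.mul_assoc]
  rfl

theorem mulVec_mem_Nmod_succ (A : Matrix (Fin n) (Fin n) R) (B : Matrix (Fin n) (Fin m) R)
    (k : ℕ) (x : Fin n → R) (hx : x ∈ Nmod R A B k) : A *ᵥ x ∈ Nmod R A B (k + 1) := by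
  suffices h : Nmod R A B k ≤ (Nmod R A B (k + 1)).comap A.mulVecLin from h hx
  refine Submodule.span_le.mpr ?_
  rintro _ ⟨i, hi, j, rfl⟩
  change A *ᵥ (fun p => (A ^ i * B) p j) ∈ Nmod R A B (k + 1)
  rw [mulVec_pow_mul_col]
  exact col_mem_Nmod A B (by omega) j

theorem Nmod_add_two_le (A : Matrix (Fin n) (Fin n) R) (B : Matrix (Fin n) (Fin m) R) (k : ℕ) :
    Nmod R A B (k + 2) ≤ Nmod R A B (k + 1) ⊔ (Nmod R A B (k + 1)).map A.mulVecLin := by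
  refine Submodule.span_le.mpr ?_
  rintro _ ⟨i, hi, j, rfl⟩
  rcases i with _ | i
  · exact Submodule.mem_sup_left (col_mem_Nmod A B (by omega) j)
  · refine Submodule.mem_sup_right ⟨_, col_mem_Nmod A B (i := i) (by omega) j, ?_⟩
    exact mulVec_pow_mul_col A B i j

theorem mem_Nmod_one_iff (A : Matrix (Fin n) (Fin n) R) (B : Matrix (Fin n) (Fin m) R)
    (x : Fin n → R) : x ∈ Nmod R A B 1 ↔ ∃ u, B *ᵥ u = x := by
  have h : Nmod R A B 1 = LinearMap.range B.mulVecLin := by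
    rw [Matrix.range_mulVecLin, Nmod]
    congr 1
    ext y
    simp [Matrix.col_def, funext_iff, eq_comm]
  rw [h]
  rfl

theorem sysReachable_iff_exists_right_inverse (A : Matrix (Fin n) (Fin n) R)
    (B : Matrix (Fin n) (Fin m) R) :
    SysReachable R A B ↔ ∃ L : Matrix (Fin n × Fin m) (Fin n) R,
      reachMatrix R A B n * L = 1 := by
  rw [SysReachable, Fintype.card_fin, ← range_reachMatrix_mulVecLin, LinearMap.range_eq_top,
    ← Matrix.mulVec_surjective_iff_exists_right_inverse]
  rfl

theorem reachMatrix_map {S : Type*} [CommRing S] (f : R →+* S) (A : Matrix (Fin n) (Fin n) R)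
    (B : Matrix (Fin n) (Fin m) R) (k : ℕ) :
    reachMatrix S (A.map f) (B.map f) k = (reachMatrix R A B k).map f := by
  ext i p
  have h : A.map f ^ (p.1 : ℕ) * B.map f = (A ^ (p.1 : ℕ) * B).map f := by
    rw [Matrix.map_mul, Matrix.map_pow]
  simp only [reachMatrix, Matrix.of_apply, h, Matrix.map_apply]

theorem SysReachable.map {S : Type*} [CommRing S] (f : R →+* S) {A : Matrix (Fin n) (Fin n) R}
    {B : Matrix (Fin n) (Fin m) R} (h : SysReachable R A B) :
    SysReachable S (A.map f) (B.map f) := by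
  rw [sysReachable_iff_exists_right_inverse] at h ⊢
  obtain ⟨L, hL⟩ := h
  refine ⟨L.map f, ?_⟩
  rw [reachMatrix_map, ← Matrix.map_mul, hL, Matrix.map_one _ f.map_zero f.map_one]

theorem MatrixEquivRel.map {S : Type*} [CommRing S] (f : R →+* S) {ι κ : Type*} [Fintype ι]
    [DecidableEq ι] [Fintype κ] [DecidableEq κ] {M M' : Matrix ι κ R}
    (h : MatrixEquivRel R M M') : MatrixEquivRel S (M.map f) (M'.map f) := by
  obtain ⟨P, Q, rfl⟩ := h
  exact ⟨GeneralLinearGroup.map f P, GeneralLinearGroup.map f Q, by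
    simp [Matrix.map_mul, GeneralLinearGroup.map]⟩

theorem MatrixEquivRel.rank_eq {ι κ : Type*} [Fintype ι]
    [DecidableEq ι] [Fintype κ] [DecidableEq κ] {M M' : Matrix ι κ R}
    (h : MatrixEquivRel R M M') : M'.rank = M.rank := by
  obtain ⟨P, Q, rfl⟩ := h
  rw [rank_mul_eq_left_of_isUnit_det _ _ ((isUnit_iff_isUnit_det _).mp Q.isUnit),
    rank_mul_eq_right_of_isUnit_det _ _ ((isUnit_iff_isUnit_det _).mp P.isUnit)]

theorem feedbackEquiv_iff_exists_matrix (A A' : Matrix (Fin n) (Fin n) R)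
    (B B' : Matrix (Fin n) (Fin m) R) :
    FeedbackEquiv R A B A' B' ↔
      ∃ (P P' : Matrix (Fin n) (Fin n) R) (Q Q' : Matrix (Fin m) (Fin m) R)
        (K : Matrix (Fin m) (Fin n) R),
        P * P' = 1 ∧ Q * Q' = 1 ∧ A' * P = P * (A + B * K) ∧ B' = P * B * Q := by
  constructor
  · rintro ⟨P, Q, K, rfl, rfl⟩
    exact ⟨P, (P⁻¹ : GL _ _), Q, (Q⁻¹ : GL _ _), K, P.mul_inv, Q.mul_inv,
      by rw [Matrix.mul_assoc, P.inv_mul, Matrix.mul_one], rfl⟩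
  · rintro ⟨P, P', Q, Q', K, hP, hQ, hA, hB⟩
    refine ⟨⟨P, P', hP, mul_eq_one_comm.mp hP⟩, ⟨Q, Q', hQ, mul_eq_one_comm.mp hQ⟩, K, ?_, hB⟩
    change A' = P * (A + B * K) * P'
    rw [← hA, Matrix.mul_assoc, hP, Matrix.mul_one]

theorem pow_add_mul_mul_eq_sum (A : Matrix (Fin n) (Fin n) R) (B : Matrix (Fin n) (Fin m) R)
    (K : Matrix (Fin m) (Fin n) R) (c : ℕ → Matrix (Fin m) (Fin m) R) (hc0 : c 0 = 1)
    (hc : ∀ l, c (l + 1) = K * ((A + B * K) ^ l * B)) (j : ℕ) :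
    (A + B * K) ^ j * B = ∑ i ∈ Finset.range (j + 1), A ^ i * B * c (j - i) := by
  induction j with
  | zero => simp [hc0]
  | succ j ih =>
    rw [Finset.sum_range_succ', pow_succ', Matrix.mul_assoc, Matrix.add_mul]
    congr 1
    · rw [ih, Matrix.mul_sum]
      refine Finset.sum_congr rfl fun i _ => ?_
      rw [pow_succ', Nat.add_sub_add_right]
      simp only [Matrix.mul_assoc]
    · simp [hc, Matrix.mul_assoc]

theorem matrixEquivRel_reachMatrix_add_mul (A : Matrix (Fin n) (Fin n) R)
    (B : Matrix (Fin n) (Fin m) R) (K : Matrix (Fin m) (Fin n) R) (k : ℕ) :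
    MatrixEquivRel R (reachMatrix R A B k) (reachMatrix R (A + B * K) B k) := by
  let c : ℕ → Matrix (Fin m) (Fin m) R := fun l =>
    Nat.casesOn l 1 fun l => K * ((A + B * K) ^ l * B)
  let T : Matrix (Fin k × Fin m) (Fin k × Fin m) R := Matrix.of fun p q =>
    if p.1 ≤ q.1 then c (q.1 - p.1 : ℕ) p.2 q.2 else 0
  have hT : T.BlockTriangular Prod.fst := fun p q h => by simp [T, not_le.mpr h]
  have hdet : T.det = 1 := by
    rw [hT.det_fintype]
    refine Finset.prod_eq_one fun i _ => ?_
    suffices h : T.toSquareBlock Prod.fst i = 1 by rw [h, det_one]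
    ext ⟨⟨a, p⟩, rfl⟩ ⟨⟨b, q⟩, h⟩
    obtain rfl : b = a := h
    simp [T, c, Matrix.toSquareBlock_def, Matrix.one_apply]
  refine ⟨1, GeneralLinearGroup.mk'' T (by simp [hdet]), ?_⟩
  ext x ⟨j, q⟩
  have h := congrFun₂ (pow_add_mul_mul_eq_sum A B K c rfl (fun _ => rfl) j) x q
  change ((A + B * K) ^ (j : ℕ) * B) x q =
    ((1 : Matrix (Fin n) (Fin n) R) * reachMatrix R A B k * T) x (j, q)
  rw [h, Matrix.one_mul, Matrix.mul_apply, Fintype.sum_prod_type, Matrix.sum_apply]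
  have hr : Finset.range (j + 1) = (Finset.range k).filter (· ≤ (j : ℕ)) := by
    ext i; have := j.2; simp; omega
  rw [hr, Finset.sum_filter, ← Fin.sum_univ_eq_sum_range
    (fun i => if i ≤ (j : ℕ) then (A ^ i * B * c (j - i)) x q else 0)]
  refine Finset.sum_congr rfl fun i _ => ?_
  by_cases hij : i ≤ j
  · simp [T, reachMatrix, hij, Matrix.mul_apply (M := A ^ (i : ℕ) * B)]
  · simp [T, hij]

theorem matrixEquivRel_reachMatrix_conj (A : Matrix (Fin n) (Fin n) R) (B : Matrix (Fin n) (Fin m) R)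
    (P : GL (Fin n) R) (Q : GL (Fin m) R) (k : ℕ) :
    MatrixEquivRel R (reachMatrix R A B k)
      (reachMatrix R ((P : Matrix (Fin n) (Fin n) R) * A * ((P⁻¹ : GL (Fin n) R) : Matrix _ _ R))
        ((P : Matrix (Fin n) (Fin n) R) * B * (Q : Matrix (Fin m) (Fin m) R)) k) := by
  let D : Matrix (Fin m) (Fin m) R → Matrix (Fin k × Fin m) (Fin k × Fin m) R :=
    fun M => Matrix.kroneckerMap (· * ·) (1 : Matrix (Fin k) (Fin k) R) M
  have hD : ∀ M N : Matrix (Fin m) (Fin m) R, M * N = 1 → D M * D N = 1 := fun M N h => by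
    simp only [D]
    rw [← Matrix.mul_kronecker_mul, h, Matrix.one_mul, Matrix.one_kronecker_one]
  refine ⟨P, ⟨D Q, D (Q⁻¹ : GL (Fin m) R), hD _ _ Q.mul_inv, hD _ _ Q.inv_mul⟩, ?_⟩
  ext x ⟨j, q⟩
  have h : ((P : Matrix (Fin n) (Fin n) R) * A * ((P⁻¹ : GL (Fin n) R) : Matrix (Fin n) (Fin n) R))
      ^ (j : ℕ) * ((P : Matrix (Fin n) (Fin n) R) * B * (Q : Matrix (Fin m) (Fin m) R)) =
      (P : Matrix (Fin n) (Fin n) R) * (A ^ (j : ℕ) * B) * (Q : Matrix (Fin m) (Fin m) R) := by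
    rw [Units.conj_pow]
    simp only [Matrix.mul_assoc]
    rw [← Matrix.mul_assoc _ (P : Matrix (Fin n) (Fin n) R), P.inv_mul, Matrix.one_mul]
  refine (congrFun₂ h x q).trans ?_
  change _ = ((P : Matrix (Fin n) (Fin n) R) * reachMatrix R A B k * D Q) x (j, q)
  simp only [Matrix.mul_assoc (P : Matrix (Fin n) (Fin n) R),
    Matrix.mul_apply (M := (P : Matrix (Fin n) (Fin n) R))]
  refine Finset.sum_congr rfl fun y _ => congrArg _ ?_
  simp [D, reachMatrix, Matrix.mul_apply (N := (Q : Matrix (Fin m) (Fin m) R)),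
    Matrix.mul_apply (M := Matrix.of _), Fintype.sum_prod_type, Matrix.one_apply]

theorem FeedbackEquiv.matrixEquivRel_reachMatrix {A A' : Matrix (Fin n) (Fin n) R}
    {B B' : Matrix (Fin n) (Fin m) R} (h : FeedbackEquiv R A B A' B') (k : ℕ) :
    MatrixEquivRel R (reachMatrix R A B k) (reachMatrix R A' B' k) := by
  obtain ⟨P, Q, K, rfl, rfl⟩ := h
  obtain ⟨P₁, Q₁, h₁⟩ := matrixEquivRel_reachMatrix_add_mul A B K k
  obtain ⟨P₂, Q₂, h₂⟩ := matrixEquivRel_reachMatrix_conj (A + B * K) B P Q k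
  exact ⟨P₂ * P₁, Q₁ * Q₂, by rw [h₂, h₁]; simp [Matrix.mul_assoc]⟩

end Reach

theorem feedbackEquiv_of_rank_reachMatrix_eq {F : Type*} [Field F] {n m : ℕ}
    (A A' : Matrix (Fin n) (Fin n) F) (B B' : Matrix (Fin n) (Fin m) F)
    (hreach : SysReachable F A B) (hreach' : SysReachable F A' B')
    (hrank : ∀ k, 1 ≤ k → k ≤ n → (reachMatrix F A B k).rank = (reachMatrix F A' B' k).rank) :
    FeedbackEquiv F A B A' B' := by
  rw [SysReachable, Fintype.card_fin] at hreach hreach'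
  obtain ⟨P, hPN, hP⟩ := exists_linearEquiv_intertwining A.mulVecLin A'.mulVecLin
    (Nmod F A B) (Nmod F A' B') rfl (Nmod_le_succ A B) (mulVec_mem_Nmod_succ A B)
    (Nmod_add_two_le A B) (Nmod_le_succ A' B') (mulVec_mem_Nmod_succ A' B')
    (Nmod_add_two_le A' B') hreach hreach' fun k hk => by
      rcases k.eq_zero_or_pos with rfl | h
      · rw [Nmod_zero, Nmod_zero]
      · rw [← range_reachMatrix_mulVecLin, ← range_reachMatrix_mulVecLin]
        exact hrank k h hk.le
  set p := LinearMap.toMatrix' P.toLinearMap with hp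
  set p' := LinearMap.toMatrix' P.symm.toLinearMap
  have hpv : ∀ x, p *ᵥ x = P x := fun x => LinearMap.toMatrix'_mulVec _ x
  have hpp : p * p' = 1 := by
    rw [← LinearMap.toMatrix'_comp]; simp
  obtain ⟨Q, hQ⟩ := exists_linearEquiv_comp_eq_of_range_eq B'.mulVecLin (p * B).mulVecLin (by
    ext y
    obtain ⟨x, rfl⟩ := P.surjective y
    change (∃ u, B' *ᵥ u = P x) ↔ ∃ u, (p * B) *ᵥ u = P x
    rw [← mem_Nmod_one_iff A', hPN, mem_Nmod_one_iff]
    simp only [← Matrix.mulVec_mulVec, hpv, P.injective.eq_iff]) rfl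
  have hK : ∀ j, ∃ u, (p * B) *ᵥ u = (A' * p - p * A).col j := fun j => by
    obtain ⟨u, hu⟩ := (mem_Nmod_one_iff A' B' _).mp (hP (Pi.single j 1))
    refine ⟨Q u, (hQ u).trans (hu.trans ?_)⟩
    rw [← Matrix.mulVec_single_one, Matrix.sub_mulVec, ← Matrix.mulVec_mulVec,
      ← Matrix.mulVec_mulVec, hpv, hpv]
    rfl
  choose K hK using hK
  refine (feedbackEquiv_iff_exists_matrix A A' B B').mpr
    ⟨p, p', LinearMap.toMatrix' Q.toLinearMap, LinearMap.toMatrix' Q.symm.toLinearMap,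
      (Matrix.of K)ᵀ, hpp, ?_, ?_, ?_⟩
  · rw [← LinearMap.toMatrix'_comp]; simp
  · rw [Matrix.mul_add, ← Matrix.mul_assoc, ← sub_eq_iff_eq_add']
    ext i j
    exact (congrFun (hK j) i).symm
  · refine Matrix.ext_of_mulVec_single fun j => ?_
    rw [← Matrix.mulVec_mulVec, LinearMap.toMatrix'_mulVec]
    exact (hQ _).symm

theorem feedbackEquiv_of_forall_isMaximal {R : Type*} [CommRing R]
    (hreg : ∀ a : R, ∃ x : R, a ^ 2 * x = a) {n m : ℕ}
    (A A' : Matrix (Fin n) (Fin n) R) (B B' : Matrix (Fin n) (Fin m) R)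
    (h : ∀ p : Ideal R, p.IsMaximal → FeedbackEquiv (R ⧸ p)
      (A.map (Ideal.Quotient.mk p)) (B.map (Ideal.Quotient.mk p))
      (A'.map (Ideal.Quotient.mk p)) (B'.map (Ideal.Quotient.mk p))) :
    FeedbackEquiv R A B A' B' := by
  have hsmul {ι κ μ : Type} [Fintype κ] {e : R} (he : e * e = e) (X : Matrix ι κ R)
      (Y : Matrix κ μ R) : e • (X * Y) = (e • X) * (e • Y) := by
    rw [Matrix.smul_mul, Matrix.mul_smul, smul_smul, he]
  have lift {ι κ : Type} (p : Ideal R) (X : Matrix ι κ (R ⧸ p)) :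
      ∃ Y : Matrix ι κ R, Y.map (Ideal.Quotient.mk p) = X := by
    choose Y hY using fun i j => Ideal.Quotient.mk_surjective (X i j)
    exact ⟨Matrix.of Y, Matrix.ext hY⟩
  have kill {ι κ : Type} [Fintype ι] [Fintype κ] (p : Ideal R) (hp : p.IsPrime)
      (X : Matrix ι κ R) (hX : X.map (Ideal.Quotient.mk p) = 0) : ∃ e ∉ p, e • X = 0 := by
    obtain ⟨e, hep, he⟩ := exists_notMem_forall_mul_eq_zero hreg p
      (fun ij : ι × κ => X ij.1 ij.2)
      fun ij => Ideal.Quotient.eq_zero_iff_mem.mp (congrFun₂ hX ij.1 ij.2)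
    exact ⟨e, hep, Matrix.ext fun i j => he (i, j)⟩
  obtain ⟨⟨P, P', Q, Q', K⟩, hx⟩ := exists_eq_zero_of_forall_isMaximal hreg
    (T := Matrix (Fin n) (Fin n) R × Matrix (Fin n) (Fin n) R × Matrix (Fin m) (Fin m) R ×
      Matrix (Fin m) (Fin m) R × Matrix (Fin m) (Fin n) R)
    (fun ⟨P, P', Q, Q', K⟩ => (P * P' - 1, Q * Q' - 1, A' * P - P * (A + B * K), B' - P * B * Q))
    (by
      rintro e he ⟨P₁, P₁', Q₁, Q₁', K₁⟩ ⟨P₂, P₂', Q₂, Q₂', K₂⟩ h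
      simp only [Prod.smul_mk, Prod.mk.injEq] at h
      obtain ⟨h1, h2, h3, h4, h5⟩ := h
      simp only [Prod.smul_mk, smul_sub, smul_add, hsmul he, h1, h2, h3, h4, h5])
    (fun p hp => by
      obtain ⟨P, P', Q, Q', K, h1, h2, h3, h4⟩ := (feedbackEquiv_iff_exists_matrix _ _ _ _).mp
        (h p hp)
      obtain ⟨P, rfl⟩ := lift p P
      obtain ⟨P', rfl⟩ := lift p P'
      obtain ⟨Q, rfl⟩ := lift p Q
      obtain ⟨Q', rfl⟩ := lift p Q'
      obtain ⟨K, rfl⟩ := lift p K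
      have hsub {ι κ : Type} (X Y : Matrix ι κ R) : (X - Y).map (Ideal.Quotient.mk p) =
        X.map (Ideal.Quotient.mk p) - Y.map (Ideal.Quotient.mk p) :=
        Matrix.map_sub _ (map_sub _) X Y
      have hadd {ι κ : Type} (X Y : Matrix ι κ R) : (X + Y).map (Ideal.Quotient.mk p) =
        X.map (Ideal.Quotient.mk p) + Y.map (Ideal.Quotient.mk p) :=
        Matrix.map_add _ (map_add _) X Y
      have hone {ι : Type} [DecidableEq ι] : (1 : Matrix ι ι R).map (Ideal.Quotient.mk p) = 1 :=
        Matrix.map_one _ (map_zero _) (map_one _)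
      obtain ⟨e₁, he₁, h1⟩ := kill p hp.isPrime (P * P' - 1)
        (by rw [hsub, Matrix.map_mul, h1, hone, sub_self])
      obtain ⟨e₂, he₂, h2⟩ := kill p hp.isPrime (Q * Q' - 1)
        (by rw [hsub, Matrix.map_mul, h2, hone, sub_self])
      obtain ⟨e₃, he₃, h3⟩ := kill p hp.isPrime (A' * P - P * (A + B * K))
        (by rw [hsub, Matrix.map_mul, Matrix.map_mul, hadd, Matrix.map_mul, h3, sub_self])
      obtain ⟨e₄, he₄, h4⟩ := kill p hp.isPrime (B' - P * B * Q)
        (by rw [hsub, Matrix.map_mul, Matrix.map_mul, h4, sub_self])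
      refine ⟨(P, P', Q, Q', K), e₁ * e₂ * (e₃ * e₄), ?_, ?_⟩
      · simp only [hp.isPrime.mul_mem_iff_mem_or_mem, not_or]
        exact ⟨⟨he₁, he₂⟩, he₃, he₄⟩
      · simp only [Prod.smul_mk, Prod.mk_eq_zero]
        refine ⟨?_, ?_, ?_, ?_⟩
        · rw [show e₁ * e₂ * (e₃ * e₄) = (e₂ * e₃ * e₄) * e₁ by ring, mul_smul, h1, smul_zero]
        · rw [show e₁ * e₂ * (e₃ * e₄) = (e₁ * e₃ * e₄) * e₂ by ring, mul_smul, h2, smul_zero]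
        · rw [show e₁ * e₂ * (e₃ * e₄) = (e₁ * e₂ * e₄) * e₃ by ring, mul_smul, h3, smul_zero]
        · rw [← mul_assoc, mul_smul, h4, smul_zero])
  simp only [Prod.mk_eq_zero, sub_eq_zero] at hx
  exact (feedbackEquiv_iff_exists_matrix _ _ _ _).mpr ⟨P, P', Q, Q', K, hx⟩

/-- two reachable systems over a commutative von Neumann regular
ring are feedback equivalent iff for every `k = 1, …, n` the partial reachability
matrices `[B | AB | ... | A^(k-1)B]` and `[B' | A'B' | ... | A'^(k-1)B']` are
equivalent matrices over `R`. -/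
theorem feedbackEquiv_iff_reachMatrix_equivalent
    {R : Type*} [CommRing R]
    (hreg : ∀ a : R, ∃ x : R, a ^ 2 * x = a)
    {n m : ℕ}
    (A A' : Matrix (Fin n) (Fin n) R) (B B' : Matrix (Fin n) (Fin m) R)
    (hreach : SysReachable R A B) (hreach' : SysReachable R A' B') :
    FeedbackEquiv R A B A' B' ↔
      ∀ k : ℕ, 1 ≤ k → k ≤ n →
        MatrixEquivRel R (reachMatrix R A B k) (reachMatrix R A' B' k) := by
  refine ⟨fun h k _ _ => h.matrixEquivRel_reachMatrix k, fun h => ?_⟩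
  refine feedbackEquiv_of_forall_isMaximal hreg A A' B B' fun p hp => ?_
  let := Ideal.Quotient.field p
  refine feedbackEquiv_of_rank_reachMatrix_eq _ _ _ _ (hreach.map _) (hreach'.map _)
    fun k hk hkn => ?_
  rw [reachMatrix_map, reachMatrix_map]
  exact ((h k hk hkn).map _).rank_eq.symm
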